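/- Let A be an invertible n×n real matrix, B an n×m real matrix with full row rank (rank B = n), Q an n×n real symmetric positive definite matrix, and R an m×m real symmetric positive definite matrix. Define ζ := ‖(Q + Q A⁻¹ B R⁻¹ Bᵀ (Aᵀ)⁻¹ Q)⁻¹‖₂ (the induced 2-norm, i.e., largest singular value), ε := λ_min(A⁻¹ B (R + Bᵀ (Aᵀ)⁻¹ Q A⁻¹ B)⁻¹ Bᵀ (Aᵀ)⁻¹) (the smallest eigenvalue), and ρ := ζ/(ζ + ε). Then ρ < 1 and for all n×n symmetric positive definite matrices X and Y, δ(R(X), R(Y)) ≤ ρ · δ(X, Y). -/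

import Mathlib

open Matrix

/-- The Riccati operator `R(P) = Q + Aᵀ(P − P B (R + Bᵀ P B)⁻¹ Bᵀ P) A`. -/
noncomputable def ricOp {n m : ℕ} (A Q : Matrix (Fin n) (Fin n) ℝ)
    (B : Matrix (Fin n) (Fin m) ℝ) (R : Matrix (Fin m) (Fin m) ℝ)
    (P : Matrix (Fin n) (Fin n) ℝ) : Matrix (Fin n) (Fin n) ℝ :=
  Q + Aᵀ * (P - P * B * (R + Bᵀ * P * B)⁻¹ * Bᵀ * P) * A

/-- The Riemannian distance on positive definite matrices. -/
noncomputable def riemannianDist {n : ℕ} (U V : Matrix (Fin n) (Fin n) ℝ) : ℝ :=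
  Real.sqrt ((((U * V⁻¹).charpoly.roots).map fun μ => (Real.log μ) ^ 2).sum)

/-- The induced 2-norm (largest singular value) of a real matrix: the operator norm of the
associated linear map between Euclidean spaces. -/
noncomputable def opNorm2 {a b : ℕ} (M : Matrix (Fin a) (Fin b) ℝ) : ℝ :=
  ‖LinearMap.toContinuousLinearMap (Matrix.toEuclideanLin M)‖

/-- The smallest (real) eigenvalue of a matrix. -/
noncomputable def lambdaMin {a : ℕ} (M : Matrix (Fin a) (Fin a) ℝ) : ℝ :=
  sInf (spectrum ℝ M)


section RiccatiContraction

variable {n m : ℕ}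

theorem Matrix.IsHermitian.exists_orthogonal_diagonalization {X : Matrix (Fin n) (Fin n) ℝ}
    (hX : X.IsHermitian) :
    ∃ W : Matrix (Fin n) (Fin n) ℝ, Wᵀ * W = 1 ∧ W * Wᵀ = 1 ∧
      Wᵀ * X * W = diagonal hX.eigenvalues := by
  refine ⟨hX.eigenvectorUnitary, ?_, ?_, ?_⟩
  · simpa [star_eq_conjTranspose] using Unitary.coe_star_mul_self hX.eigenvectorUnitary
  · simpa [star_eq_conjTranspose] using Unitary.coe_mul_star_self hX.eigenvectorUnitary
  · have h := hX.conjStarAlgAut_star_eigenvectorUnitary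
    simpa [Unitary.conjStarAlgAut_apply, star_eq_conjTranspose, Function.comp_def] using h

/-- Simultaneous diagonalization by congruence of two positive definite matrices, with the
generalized eigenvalues in decreasing order. -/
theorem exists_congruence_one_diagonal {X Y : Matrix (Fin n) (Fin n) ℝ}
    (hX : X.PosDef) (hY : Y.PosDef) :
    ∃ (V : Matrix (Fin n) (Fin n) ℝ) (d : Fin n → ℝ), Antitone d ∧ (∀ i, 0 < d i) ∧
      Vᵀ * Y * V = 1 ∧ Vᵀ * X * V = diagonal d := by
  obtain ⟨W, hW1, hW2, hW⟩ := hY.isHermitian.exists_orthogonal_diagonalization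
  set y := hY.isHermitian.eigenvalues with hy
  have hypos : ∀ i, 0 < y i := hY.eigenvalues_pos
  set M := W * diagonal (fun i => (Real.sqrt (y i))⁻¹) with hM
  have hMY : Mᵀ * Y * M = 1 := by
    have : Mᵀ * Y * M = diagonal (fun i => (Real.sqrt (y i))⁻¹) * (Wᵀ * Y * W) *
        diagonal (fun i => (Real.sqrt (y i))⁻¹) := by
      simp [hM, Matrix.mul_assoc]
    rw [this, hW, diagonal_mul_diagonal, diagonal_mul_diagonal, ← diagonal_one]
    congr 1
    funext i
    have h1 := Real.mul_self_sqrt (hypos i).le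
    have h2 : Real.sqrt (y i) ≠ 0 := (Real.sqrt_pos.2 (hypos i)).ne'
    field_simp
    rw [sq, h1]
  have hMu : IsUnit M := IsUnit.of_mul_eq_one_right _ hMY
  have hN : (Mᵀ * X * M).PosDef := by
    simpa using hX.conjTranspose_mul_mul_same (Matrix.mulVec_injective_of_isUnit hMu)
  obtain ⟨U, hU1, hU2, hU⟩ := hN.isHermitian.exists_orthogonal_diagonalization
  set e := hN.isHermitian.eigenvalues with he
  have hepos : ∀ i, 0 < e i := hN.eigenvalues_pos
  set σ : Equiv.Perm (Fin n) := Fin.revPerm.trans (Tuple.sort e) with hσ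
  have key : ∀ Z : Matrix (Fin n) (Fin n) ℝ,
      ((M * U).submatrix id σ)ᵀ * Z * (M * U).submatrix id σ =
        (Uᵀ * (Mᵀ * Z * M) * U).submatrix σ σ := by
    intro Z
    rw [transpose_submatrix]
    have : (Uᵀ * (Mᵀ * Z * M) * U) = (M * U)ᵀ * Z * (M * U) := by
      simp [Matrix.mul_assoc]
    rw [this]
    ext i j
    simp [Matrix.mul_apply]
  refine ⟨(M * U).submatrix id σ, e ∘ σ, ?_, fun i => hepos _, ?_, ?_⟩
  · intro i j hij
    have := Tuple.monotone_sort e (Fin.rev_le_rev.2 hij)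
    simpa [hσ] using this
  · rw [key, hMY, Matrix.mul_one, hU1]
    simp
  · rw [key, hU]
    simp

theorem riemannianDist_eq_of_congruence {X Y V : Matrix (Fin n) (Fin n) ℝ} {d : Fin n → ℝ}
    (hVY : Vᵀ * Y * V = 1) (hVX : Vᵀ * X * V = diagonal d) :
    riemannianDist X Y = Real.sqrt (∑ i, (Real.log (d i)) ^ 2) := by
  have h1 : V * (Vᵀ * Y) = 1 := mul_eq_one_comm.1 hVY
  have h2 : Y⁻¹ = V * Vᵀ := inv_eq_left_inv (by rw [Matrix.mul_assoc, h1])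
  have h3 : (X * Y⁻¹).charpoly = (diagonal d).charpoly := by
    rw [h2, ← Matrix.mul_assoc, charpoly_mul_comm, ← Matrix.mul_assoc, hVX]
  have h4 : (∏ i, (Polynomial.X - Polynomial.C (d i))).roots = Finset.univ.val.map d := by
    have h := Polynomial.roots_multiset_prod_X_sub_C (Finset.univ.val.map d)
    rwa [Multiset.map_map] at h
  rw [riemannianDist, h3, charpoly_diagonal, h4, Multiset.map_map]
  rfl

theorem riemannianDist_inv {X Y : Matrix (Fin n) (Fin n) ℝ} (hX : X.PosDef) (hY : Y.PosDef) :
    riemannianDist X⁻¹ Y⁻¹ = riemannianDist X Y := by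
  obtain ⟨V, d, -, hd, hVY, hVX⟩ := exists_congruence_one_diagonal hX hY
  have hYu : IsUnit Y.det := (isUnit_iff_isUnit_det _).1 hY.isUnit
  have hYt : Yᵀ = Y := by simpa using hY.isHermitian.eq
  have h1 : V * (Vᵀ * Y) = 1 := mul_eq_one_comm.1 hVY
  have hX' : X⁻¹ = V * diagonal (fun i => (d i)⁻¹) * Vᵀ := by
    refine inv_eq_left_inv ?_
    calc V * diagonal (fun i => (d i)⁻¹) * Vᵀ * X
        = V * diagonal (fun i => (d i)⁻¹) * (Vᵀ * X * V) * (Vᵀ * Y) := by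
          rw [← Matrix.mul_one (V * diagonal (fun i => (d i)⁻¹) * Vᵀ * X), ← h1]
          simp only [Matrix.mul_assoc]
      _ = 1 := by
          rw [hVX, Matrix.mul_assoc V, diagonal_mul_diagonal]
          have : (fun i => (d i)⁻¹ * d i) = fun _ => 1 := by
            funext i
            exact inv_mul_cancel₀ (hd i).ne'
          rw [this, diagonal_one, Matrix.mul_one, h1]
  have hWY : (Y * V)ᵀ * Y⁻¹ * (Y * V) = 1 := by
    rw [transpose_mul, hYt, Matrix.mul_assoc _ _ (Y * V), nonsing_inv_mul_cancel_left _ _ hYu, hVY]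
  have hWX : (Y * V)ᵀ * X⁻¹ * (Y * V) = diagonal (fun i => (d i)⁻¹) := by
    calc (Y * V)ᵀ * X⁻¹ * (Y * V)
        = (Vᵀ * Y * V) * diagonal (fun i => (d i)⁻¹) * (Vᵀ * Y * V) := by
          rw [hX', transpose_mul, hYt]
          simp only [Matrix.mul_assoc]
      _ = _ := by rw [hVY, Matrix.one_mul, Matrix.mul_one]
  rw [riemannianDist_eq_of_congruence hWY hWX, riemannianDist_eq_of_congruence hVY hVX]
  simp [Real.log_inv]

theorem riemannianDist_congr {L : Matrix (Fin n) (Fin n) ℝ} (hL : IsUnit L.det)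
    (X Y : Matrix (Fin n) (Fin n) ℝ) :
    riemannianDist (L * X * Lᵀ) (L * Y * Lᵀ) = riemannianDist X Y := by
  have hLt : IsUnit Lᵀ.det := by rwa [det_transpose]
  have : (L * X * Lᵀ * (L * Y * Lᵀ)⁻¹).charpoly = (X * Y⁻¹).charpoly := by
    rw [Matrix.mul_inv_rev, Matrix.mul_inv_rev, Matrix.mul_assoc (L * X), ← Matrix.mul_assoc Lᵀ,
      mul_nonsing_inv _ hLt, Matrix.one_mul, Matrix.mul_assoc, charpoly_mul_comm,
      Matrix.mul_assoc, Matrix.mul_assoc, nonsing_inv_mul _ hL, Matrix.mul_one]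
  rw [riemannianDist, riemannianDist, this]

theorem exists_ne_zero_mulVec_eq_zero_of_partition (G : Matrix (Fin n) (Fin n) ℝ)
    (p : Fin n → Prop) (k : Fin n) :
    ∃ c : Fin n → ℝ, c ≠ 0 ∧ (∀ j, j ≠ k → p j → (G *ᵥ c) j = 0) ∧
      ∀ j, j ≠ k → ¬ p j → c j = 0 := by
  classical
  set K : Matrix (Fin n) (Fin n) ℝ :=
    fun j => if j = k then 0 else if p j then G j else Pi.single j 1 with hK
  have hdet : K.det = 0 := det_eq_zero_of_row_eq_zero k (fun j => by simp [hK])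
  obtain ⟨c, hc, hKc⟩ := exists_mulVec_eq_zero_iff.2 hdet
  refine ⟨c, hc, fun j hj hp => ?_, fun j hj hp => ?_⟩
  · have := congrFun hKc j
    simpa [mulVec, hK, hj, hp] using this
  · have := congrFun hKc j
    simpa [mulVec, hK, hj, hp] using this

theorem quadForm_congruence (X V : Matrix (Fin n) (Fin n) ℝ) (c : Fin n → ℝ) :
    (V *ᵥ c) ⬝ᵥ (X *ᵥ (V *ᵥ c)) = c ⬝ᵥ ((Vᵀ * X * V) *ᵥ c) := by
  rw [← mulVec_mulVec, ← mulVec_mulVec, dotProduct_mulVec c, vecMul_transpose]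

theorem rpow_div_le_add_div_add {x y u ρ : ℝ} (hy : 0 < y) (hyx : y ≤ x) (hu : 0 < u + x)
    (hu' : 0 ≤ u) (hρ : x ≤ ρ * (u + x)) : (y / x) ^ ρ ≤ (u + y) / (u + x) := by
  have hx : 0 < x := hy.trans_le hyx
  set θ := x / (u + x) with hθ
  have hθρ : θ ≤ ρ := by rw [hθ, div_le_iff₀ hu]; exact hρ
  have h1 : (y / x) ^ ρ ≤ (y / x) ^ θ :=
    Real.rpow_le_rpow_of_exponent_ge (by positivity) ((div_le_one hx).2 hyx) hθρ
  have h2 := Real.geom_mean_le_arith_mean2_weighted (w₁ := 1 - θ) (w₂ := θ) (p₁ := 1) (p₂ := y / x)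
    (by rw [hθ, sub_nonneg, div_le_one hu]; linarith) (by positivity) zero_le_one (by positivity)
    (by ring)
  rw [Real.one_rpow, one_mul] at h2
  refine h1.trans (h2.trans_eq ?_)
  rw [hθ]
  field_simp
  ring

/-- Adding `u` contracts logarithmic ratios. -/
theorem log_add_div_add_le {x y u ρ : ℝ} (hy : 0 < y) (hyx : y ≤ x)
    (hu : 0 ≤ u) (hρ : x ≤ ρ * (u + x)) :
    Real.log ((u + x) / (u + y)) ≤ ρ * Real.log (x / y) := by
  have hx : 0 < x := hy.trans_le hyx
  have h := Real.log_le_log (by positivity) (rpow_div_le_add_div_add hy hyx (by linarith) hu hρ)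
  rw [Real.log_rpow (by positivity), ← inv_div x y, ← inv_div (u + x) (u + y), Real.log_inv,
    Real.log_inv] at h
  linarith

/-- Translating by a positive semidefinite matrix contracts the Riemannian distance. -/
theorem riemannianDist_add_le {U X Y : Matrix (Fin n) (Fin n) ℝ} {ρ : ℝ}
    (hρ0 : 0 ≤ ρ) (hU : U.PosSemidef) (hX : X.PosDef) (hY : Y.PosDef)
    (hρX : ∀ v : Fin n → ℝ, v ⬝ᵥ (X *ᵥ v) ≤ ρ * (v ⬝ᵥ (U *ᵥ v) + v ⬝ᵥ (X *ᵥ v)))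
    (hρY : ∀ v : Fin n → ℝ, v ⬝ᵥ (Y *ᵥ v) ≤ ρ * (v ⬝ᵥ (U *ᵥ v) + v ⬝ᵥ (Y *ᵥ v))) :
    riemannianDist (U + X) (U + Y) ≤ ρ * riemannianDist X Y := by
  obtain ⟨V, d, hdm, hd, hVY, hVX⟩ := exists_congruence_one_diagonal hX hY
  obtain ⟨W, e, hem, he, hWY, hWX⟩ := exists_congruence_one_diagonal
    (PosDef.posSemidef_add hU hX) (PosDef.posSemidef_add hU hY)
  have hVinv : V * (Vᵀ * Y) = 1 := mul_eq_one_comm.1 hVY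
  set G := Vᵀ * Y * W with hG
  have hWG : ∀ c : Fin n → ℝ, W *ᵥ c = V *ᵥ (G *ᵥ c) := by
    intro c
    rw [hG, mulVec_mulVec, ← Matrix.mul_assoc, hVinv, Matrix.one_mul]
  have hWinj : ∀ c : Fin n → ℝ, c ≠ 0 → W *ᵥ c ≠ 0 := by
    intro c hc h
    apply hc
    have := congrArg (fun w => (Wᵀ * (U + Y)) *ᵥ w) h
    simpa [mulVec_mulVec, hWY] using this
  have hUv : ∀ v : Fin n → ℝ, 0 ≤ v ⬝ᵥ (U *ᵥ v) := fun v => by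
    simpa using hU.dotProduct_mulVec_nonneg v
  have hXv : ∀ v : Fin n → ℝ, v ≠ 0 → 0 < v ⬝ᵥ (X *ᵥ v) := fun v hv => by
    simpa using hX.dotProduct_mulVec_pos hv
  have hYv : ∀ v : Fin n → ℝ, v ≠ 0 → 0 < v ⬝ᵥ (Y *ᵥ v) := fun v hv => by
    simpa using hY.dotProduct_mulVec_pos hv
  have hq1 : ∀ c : Fin n → ℝ, (W *ᵥ c) ⬝ᵥ (U *ᵥ (W *ᵥ c)) + (W *ᵥ c) ⬝ᵥ (Y *ᵥ (W *ᵥ c)) =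
      ∑ i, c i ^ 2 := fun c => by
    rw [← dotProduct_add, ← add_mulVec, quadForm_congruence, hWY, one_mulVec]
    simp [dotProduct, sq]
  have hq2 : ∀ c : Fin n → ℝ, (W *ᵥ c) ⬝ᵥ (U *ᵥ (W *ᵥ c)) + (W *ᵥ c) ⬝ᵥ (X *ᵥ (W *ᵥ c)) =
      ∑ i, e i * c i ^ 2 := fun c => by
    rw [← dotProduct_add, ← add_mulVec, quadForm_congruence, hWX]
    simp only [dotProduct, mulVec_diagonal]
    exact Finset.sum_congr rfl fun i _ => by ring
  have hq3 : ∀ c : Fin n → ℝ, (W *ᵥ c) ⬝ᵥ (Y *ᵥ (W *ᵥ c)) = ∑ i, (G *ᵥ c) i ^ 2 := fun c => by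
    rw [hWG, quadForm_congruence, hVY, one_mulVec]
    simp [dotProduct, sq]
  have hq4 : ∀ c : Fin n → ℝ, (W *ᵥ c) ⬝ᵥ (X *ᵥ (W *ᵥ c)) = ∑ i, d i * (G *ᵥ c) i ^ 2 :=
    fun c => by
    rw [hWG, quadForm_congruence, hVX]
    simp only [dotProduct, mulVec_diagonal]
    exact Finset.sum_congr rfl fun i _ => by ring
  have key : ∀ k, |Real.log (e k)| ≤ ρ * |Real.log (d k)| := by
    intro k
    rcases le_total 1 (e k) with hk | hk
    · obtain ⟨c, hc, hc1, hc2⟩ := exists_ne_zero_mulVec_eq_zero_of_partition G (fun j => j < k) k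
      have hv := hWinj c hc
      specialize hq1 c; specialize hq2 c; specialize hq3 c; specialize hq4 c
      set v := W *ᵥ c
      have hu := hUv v
      have hx := hXv v hv
      have hy := hYv v hv
      have h1 : e k * (v ⬝ᵥ (U *ᵥ v) + v ⬝ᵥ (Y *ᵥ v)) ≤ v ⬝ᵥ (U *ᵥ v) + v ⬝ᵥ (X *ᵥ v) := by
        rw [hq1, hq2, Finset.mul_sum]
        refine Finset.sum_le_sum fun i _ => ?_
        rcases le_or_gt i k with hi | hi
        · exact mul_le_mul_of_nonneg_right (hem hi) (sq_nonneg _)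
        · simp [hc2 i hi.ne' (not_lt.2 hi.le)]
      have h2 : v ⬝ᵥ (X *ᵥ v) ≤ d k * (v ⬝ᵥ (Y *ᵥ v)) := by
        rw [hq3, hq4, Finset.mul_sum]
        refine Finset.sum_le_sum fun i _ => ?_
        rcases le_or_gt k i with hi | hi
        · exact mul_le_mul_of_nonneg_right (hdm hi) (sq_nonneg _)
        · simp [hc1 i hi.ne hi]
      have hyx : v ⬝ᵥ (Y *ᵥ v) ≤ v ⬝ᵥ (X *ᵥ v) := by nlinarith
      rw [← le_div_iff₀ (by linarith)] at h1
      rw [← div_le_iff₀ hy] at h2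
      have h3 := log_add_div_add_le hy hyx hu (hρX v)
      have h4 := Real.log_le_log (he k) h1
      have h5 := Real.log_le_log (by positivity) h2
      have h6 := mul_le_mul_of_nonneg_left (h5.trans (le_abs_self _)) hρ0
      rw [abs_of_nonneg (Real.log_nonneg hk)]
      linarith
    · obtain ⟨c, hc, hc1, hc2⟩ := exists_ne_zero_mulVec_eq_zero_of_partition G (fun j => k < j) k
      have hv := hWinj c hc
      specialize hq1 c; specialize hq2 c; specialize hq3 c; specialize hq4 c
      set v := W *ᵥ c
      have hu := hUv v
      have hx := hXv v hv
      have hy := hYv v hv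
      have h1 : v ⬝ᵥ (U *ᵥ v) + v ⬝ᵥ (X *ᵥ v) ≤ e k * (v ⬝ᵥ (U *ᵥ v) + v ⬝ᵥ (Y *ᵥ v)) := by
        rw [hq1, hq2, Finset.mul_sum]
        refine Finset.sum_le_sum fun i _ => ?_
        rcases le_or_gt k i with hi | hi
        · exact mul_le_mul_of_nonneg_right (hem hi) (sq_nonneg _)
        · simp [hc2 i hi.ne (not_lt.2 hi.le)]
      have h2 : d k * (v ⬝ᵥ (Y *ᵥ v)) ≤ v ⬝ᵥ (X *ᵥ v) := by
        rw [hq3, hq4, Finset.mul_sum]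
        refine Finset.sum_le_sum fun i _ => ?_
        rcases le_or_gt i k with hi | hi
        · exact mul_le_mul_of_nonneg_right (hdm hi) (sq_nonneg _)
        · simp [hc1 i hi.ne' hi]
      have hxy : v ⬝ᵥ (X *ᵥ v) ≤ v ⬝ᵥ (Y *ᵥ v) := by nlinarith
      rw [← div_le_iff₀ (by linarith)] at h1
      rw [← le_div_iff₀ hy] at h2
      have h3 := log_add_div_add_le hx hxy hu (hρY v)
      rw [← inv_div, Real.log_inv, ← inv_div (v ⬝ᵥ (X *ᵥ v)), Real.log_inv] at h3
      have h4 := Real.log_le_log (by positivity) h1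
      have h5 := Real.log_le_log (hd k) h2
      have h6 := mul_le_mul_of_nonneg_left ((neg_le_neg h5).trans (neg_le_abs _)) hρ0
      rw [abs_of_nonpos (Real.log_nonpos (he k).le hk)]
      linarith
  rw [riemannianDist_eq_of_congruence hWY hWX, riemannianDist_eq_of_congruence hVY hVX,
    ← Real.sqrt_sq hρ0, ← Real.sqrt_mul (sq_nonneg ρ), Finset.mul_sum]
  refine Real.sqrt_le_sqrt (Finset.sum_le_sum fun k _ => ?_)
  rw [← mul_pow, ← sq_abs, ← sq_abs (ρ * _), abs_mul, abs_of_nonneg hρ0]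
  exact pow_le_pow_left₀ (abs_nonneg _) (key k) 2

/-- The binomial inverse identity for positive definite matrices. -/
theorem Matrix.PosDef.add_inv_eq_sub {M N : Matrix (Fin n) (Fin n) ℝ} (hM : M.PosDef)
    (hN : N.PosDef) : (M + N)⁻¹ = M⁻¹ - M⁻¹ * (N⁻¹ + M⁻¹)⁻¹ * M⁻¹ := by
  have h := add_mul_mul_inv_eq_sub M 1 N 1 hM.isUnit hN.isUnit
    (by simpa using (hN.inv.add hM.inv).isUnit)
  simpa using h

theorem Matrix.PosDef.inv_inv {M : Matrix (Fin n) (Fin n) ℝ} (hM : M.PosDef) : M⁻¹⁻¹ = M :=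
  nonsing_inv_nonsing_inv _ ((isUnit_iff_isUnit_det _).1 hM.isUnit)

theorem Matrix.PosDef.mul_mul_transpose_same {k : ℕ} {M : Matrix (Fin m) (Fin m) ℝ}
    (hM : M.PosDef) {C : Matrix (Fin k) (Fin m) ℝ} (hC : Function.Injective C.vecMul) :
    (C * M * Cᵀ).PosDef := by
  simpa using hM.mul_mul_conjTranspose_same hC

theorem Matrix.PosDef.transpose_mul_mul_posSemidef {k : ℕ} {M : Matrix (Fin m) (Fin m) ℝ}
    (hM : M.PosDef) (C : Matrix (Fin m) (Fin k) ℝ) : (Cᵀ * M * C).PosSemidef := by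
  simpa using hM.posSemidef.conjTranspose_mul_mul_same C

theorem Matrix.PosDef.woodbury {X : Matrix (Fin n) (Fin n) ℝ} {R : Matrix (Fin m) (Fin m) ℝ}
    (hX : X.PosDef) (hR : R.PosDef) (C : Matrix (Fin n) (Fin m) ℝ) :
    (X⁻¹ + C * R⁻¹ * Cᵀ)⁻¹ = X - X * C * (R + Cᵀ * X * C)⁻¹ * Cᵀ * X := by
  have h := add_mul_mul_inv_eq_sub X⁻¹ C R⁻¹ Cᵀ hX.inv.isUnit hR.inv.isUnit
    (by rw [hX.inv_inv, hR.inv_inv]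
        exact (hR.add_posSemidef (hX.transpose_mul_mul_posSemidef C)).isUnit)
  rwa [hX.inv_inv, hR.inv_inv] at h

theorem vecMul_injective_of_rank_eq {B : Matrix (Fin n) (Fin m) ℝ} (hB : B.rank = n) :
    Function.Injective B.vecMul := by
  rw [vecMul_injective_iff, linearIndependent_iff_card_eq_finrank_span, Set.finrank,
    ← rank_eq_finrank_span_row, hB, Fintype.card_fin]

theorem lambdaMin_mul_dotProduct_le {M : Matrix (Fin n) (Fin n) ℝ} (hM : M.IsHermitian)
    (v : Fin n → ℝ) : lambdaMin M * (v ⬝ᵥ v) ≤ v ⬝ᵥ (M *ᵥ v) := by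
  obtain ⟨W, -, hW2, hW⟩ := hM.exists_orthogonal_diagonalization
  have hle : ∀ i, lambdaMin M ≤ hM.eigenvalues i := fun i =>
    csInf_le M.finite_real_spectrum.bddBelow (hM.eigenvalues_mem_spectrum_real i)
  have hv : W *ᵥ (Wᵀ *ᵥ v) = v := by rw [mulVec_mulVec, hW2, one_mulVec]
  have h1 := quadForm_congruence M W (Wᵀ *ᵥ v)
  have h2 : v ⬝ᵥ v = (Wᵀ *ᵥ v) ⬝ᵥ (Wᵀ *ᵥ v) := by
    conv_lhs => rw [← hv]
    rw [hv, mulVec_transpose, ← dotProduct_mulVec, ← mulVec_transpose, hv]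
  rw [hv, hW] at h1
  rw [h1, h2]
  simp only [dotProduct, mulVec_diagonal, Finset.mul_sum]
  refine Finset.sum_le_sum fun i _ => ?_
  nlinarith [mul_le_mul_of_nonneg_right (hle i) (mul_self_nonneg ((Wᵀ *ᵥ v) i))]

theorem lambdaMin_pos [NeZero n] {M : Matrix (Fin n) (Fin n) ℝ} (hM : M.PosDef) :
    0 < lambdaMin M := by
  have hne : (spectrum ℝ M).Nonempty := ⟨_, hM.isHermitian.eigenvalues_mem_spectrum_real 0⟩
  have hmem := hne.csInf_mem M.finite_real_spectrum
  rw [hM.isHermitian.spectrum_real_eq_range_eigenvalues] at hmem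
  obtain ⟨i, hi⟩ := hmem
  rw [lambdaMin, hM.isHermitian.spectrum_real_eq_range_eigenvalues, ← hi]
  exact hM.eigenvalues_pos i

theorem dotProduct_mulVec_le_opNorm2_mul (M : Matrix (Fin n) (Fin n) ℝ) (v : Fin n → ℝ) :
    v ⬝ᵥ (M *ᵥ v) ≤ opNorm2 M * (v ⬝ᵥ v) := by
  set w : EuclideanSpace ℝ (Fin n) := WithLp.toLp 2 v
  set L := LinearMap.toContinuousLinearMap (Matrix.toEuclideanLin M)
  have h1 : inner ℝ (L w) w = v ⬝ᵥ (M *ᵥ v) := by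
    rw [EuclideanSpace.inner_eq_star_dotProduct]
    simp [L, w]
  have h2 : ‖w‖ * ‖w‖ = v ⬝ᵥ v := by
    rw [← real_inner_self_eq_norm_mul_norm, EuclideanSpace.inner_eq_star_dotProduct]
    simp [w]
  rw [← h1, ← h2, opNorm2, ← mul_assoc]
  exact (real_inner_le_norm _ _).trans
    (mul_le_mul_of_nonneg_right (L.le_opNorm w) (norm_nonneg _))

theorem opNorm2_nonneg (M : Matrix (Fin n) (Fin m) ℝ) : 0 ≤ opNorm2 M := norm_nonneg _

theorem ricOp_eq_add_inv {A Q X : Matrix (Fin n) (Fin n) ℝ} {B : Matrix (Fin n) (Fin m) ℝ}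
    {R : Matrix (Fin m) (Fin m) ℝ} (hA : IsUnit A.det) (hX : X.PosDef) (hR : R.PosDef) :
    ricOp A Q B R X = Q + ((Aᵀ * X * A)⁻¹ + A⁻¹ * B * R⁻¹ * (A⁻¹ * B)ᵀ)⁻¹ := by
  have hAt : IsUnit Aᵀ.det := by rwa [det_transpose]
  have h : (Aᵀ * X * A)⁻¹ + A⁻¹ * B * R⁻¹ * (A⁻¹ * B)ᵀ =
      A⁻¹ * (X⁻¹ + B * R⁻¹ * Bᵀ) * Aᵀ⁻¹ := by
    rw [transpose_mul, transpose_nonsing_inv, Matrix.mul_inv_rev, Matrix.mul_inv_rev]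
    simp only [Matrix.mul_assoc, Matrix.mul_add, Matrix.add_mul]
  rw [ricOp, ← hX.woodbury hR B, h, Matrix.mul_inv_rev, Matrix.mul_inv_rev,
    nonsing_inv_nonsing_inv _ hA, nonsing_inv_nonsing_inv _ hAt, Matrix.mul_assoc]

/-- In inverse coordinates the Riccati operator is a congruence followed by a translation. -/
theorem inv_add_inv_inv_add {Q Z T : Matrix (Fin n) (Fin n) ℝ} (hQ : Q.PosDef) (hZ : Z.PosDef)
    (hT : T.PosDef) :
    (Q + (Z⁻¹ + T)⁻¹)⁻¹ = (Q⁻¹ - Q⁻¹ * (Q⁻¹ + T)⁻¹ * Q⁻¹) +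
      Q⁻¹ * (Q⁻¹ + T)⁻¹ * ((Q⁻¹ + T)⁻¹ + Z)⁻¹ * (Q⁻¹ * (Q⁻¹ + T)⁻¹)ᵀ := by
  have hZT := hZ.inv.add hT
  have hG := hQ.inv.add hT
  have hGt : ((Q⁻¹ + T)⁻¹)ᵀ = (Q⁻¹ + T)⁻¹ := by simpa using hG.inv.isHermitian.eq
  have hQt : (Q⁻¹)ᵀ = Q⁻¹ := by simpa using hQ.inv.isHermitian.eq
  have h1 : (Z⁻¹ + T) + Q⁻¹ = (Q⁻¹ + T) + Z⁻¹ := by abel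
  rw [hQ.add_inv_eq_sub hZT.inv, hZT.inv_inv, h1, hG.add_inv_eq_sub hZ.inv, hZ.inv_inv,
    transpose_mul, hGt, hQt, add_comm _ Z]
  noncomm_ring

end RiccatiContraction

/-- If `Q` is positive definite and `B` has full row rank, then the
Riccati operator is a strict contraction in the Riemannian distance, with rate
`ρ = ζ/(ζ+ε) < 1`. -/
theorem riccati_strict_contraction {n m : ℕ}
    (A Q : Matrix (Fin n) (Fin n) ℝ) (B : Matrix (Fin n) (Fin m) ℝ)
    (R : Matrix (Fin m) (Fin m) ℝ)
    (hA : IsUnit A.det) (hB : B.rank = n) (hQ : Q.PosDef) (hR : R.PosDef)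
    (ζ ε ρ : ℝ)
    (hζ : ζ = opNorm2 ((Q + Q * A⁻¹ * B * R⁻¹ * Bᵀ * Aᵀ⁻¹ * Q)⁻¹))
    (hε : ε = lambdaMin (A⁻¹ * B * (R + Bᵀ * Aᵀ⁻¹ * Q * A⁻¹ * B)⁻¹ * Bᵀ * Aᵀ⁻¹))
    (hρ : ρ = ζ / (ζ + ε)) :
    ρ < 1 ∧
      ∀ X Y : Matrix (Fin n) (Fin n) ℝ, X.PosDef → Y.PosDef →
        riemannianDist (ricOp A Q B R X) (ricOp A Q B R Y) ≤ ρ * riemannianDist X Y := by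
  rcases Nat.eq_zero_or_pos n with hn | hn
  · subst hn
    have hζ0 : ζ = 0 := by
      rw [hζ, opNorm2, Subsingleton.elim (LinearMap.toContinuousLinearMap _) 0, norm_zero]
    rw [hρ, hζ0, zero_div]
    exact ⟨zero_lt_one, fun X Y _ _ => by simp [riemannianDist, Matrix.charpoly]⟩
  have : NeZero n := ⟨hn.ne'⟩
  have hAi : IsUnit A⁻¹ := (isUnit_iff_isUnit_det _).2 (isUnit_nonsing_inv_det A hA)
  set C := A⁻¹ * B with hC
  have hCt : Cᵀ = Bᵀ * Aᵀ⁻¹ := by rw [hC, transpose_mul, transpose_nonsing_inv]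
  have hCinj : Function.Injective C.vecMul := by
    intro v w hvw
    simp only [hC, ← vecMul_vecMul] at hvw
    exact vecMul_injective_of_isUnit hAi (vecMul_injective_of_rank_eq hB hvw)
  set T := C * R⁻¹ * Cᵀ with hTdef
  have hT : T.PosDef := hR.inv.mul_mul_transpose_same hCinj
  have hG := hQ.inv.add hT
  have hQu : IsUnit Q.det := (isUnit_iff_isUnit_det _).1 hQ.isUnit
  have hGu : IsUnit (Q⁻¹ + T).det := (isUnit_iff_isUnit_det _).1 hG.isUnit
  set E := C * (R + Cᵀ * Q * C)⁻¹ * Cᵀ with hEdef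
  have hE : E.PosDef := (hR.add_posSemidef
    (hQ.transpose_mul_mul_posSemidef C)).inv.mul_mul_transpose_same hCinj
  have hEeq : Q⁻¹ - Q⁻¹ * (Q⁻¹ + T)⁻¹ * Q⁻¹ = E := by
    have h : (Q⁻¹ + T)⁻¹ = Q - Q * E * Q := by
      rw [hTdef, hQ.woodbury hR C, hEdef]
      simp only [Matrix.mul_assoc]
    rw [h, Matrix.mul_sub, Matrix.sub_mul, nonsing_inv_mul _ hQu, Matrix.one_mul,
      Matrix.mul_assoc Q E Q, nonsing_inv_mul_cancel_left _ _ hQu,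
      mul_nonsing_inv_cancel_right _ _ hQu, sub_sub_cancel]
  have hε' : ε = lambdaMin E := by
    rw [hε, hEdef, hCt, hC]
    simp only [Matrix.mul_assoc]
  have hζ' : ζ = opNorm2 (Q * (Q⁻¹ + T) * Q)⁻¹ := by
    rw [hζ, hTdef, Matrix.mul_add, Matrix.add_mul, mul_nonsing_inv _ hQu, Matrix.one_mul, hCt, hC]
    simp only [Matrix.mul_assoc]
  have hε0 : 0 < ε := hε' ▸ lambdaMin_pos hE
  have hζ0 : 0 ≤ ζ := hζ' ▸ opNorm2_nonneg _
  have hρ0 : 0 ≤ ρ := hρ ▸ div_nonneg hζ0 (by linarith)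
  refine ⟨by rw [hρ, div_lt_one (by linarith)]; linarith, fun X Y hX hY => ?_⟩
  have hAinj : Function.Injective Aᵀ.vecMul :=
    vecMul_injective_of_isUnit ((isUnit_iff_isUnit_det _).2 (by rwa [det_transpose]))
  have hcongr : ∀ {P : Matrix (Fin n) (Fin n) ℝ}, P.PosDef → (Aᵀ * P * A).PosDef := fun hP => by
    simpa using hP.mul_mul_transpose_same hAinj
  have hric : ∀ {P : Matrix (Fin n) (Fin n) ℝ}, P.PosDef → (ricOp A Q B R P).PosDef := fun hP => by
    rw [ricOp_eq_add_inv hA hP hR]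
    exact hQ.add ((hcongr hP).inv.add hT).inv
  set K := Q⁻¹ * (Q⁻¹ + T)⁻¹ with hK
  have hKu : IsUnit K := hQ.inv.isUnit.mul hG.inv.isUnit
  have hKdet := (isUnit_iff_isUnit_det _).1 hKu
  have hinv : ∀ {P : Matrix (Fin n) (Fin n) ℝ}, P.PosDef → (ricOp A Q B R P)⁻¹ =
      E + K * ((Q⁻¹ + T)⁻¹ + Aᵀ * P * A)⁻¹ * Kᵀ := fun hP => by
    rw [ricOp_eq_add_inv hA hP hR, inv_add_inv_inv_add hQ (hcongr hP) hT, hEeq]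
  have hKGK : K * (Q⁻¹ + T) * Kᵀ = (Q * (Q⁻¹ + T) * Q)⁻¹ := by
    have hGt : ((Q⁻¹ + T)⁻¹)ᵀ = (Q⁻¹ + T)⁻¹ := by simpa using hG.inv.isHermitian.eq
    have hQt : (Q⁻¹)ᵀ = Q⁻¹ := by simpa using hQ.inv.isHermitian.eq
    rw [hK, transpose_mul, hGt, hQt, Matrix.mul_inv_rev, Matrix.mul_inv_rev,
      nonsing_inv_mul_cancel_right _ _ hGu]
  have hsum : ∀ {P : Matrix (Fin n) (Fin n) ℝ}, P.PosDef →
      ((Q⁻¹ + T)⁻¹ + Aᵀ * P * A).PosDef := fun hP => hG.inv.add (hcongr hP)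
  have hKP : ∀ {P : Matrix (Fin n) (Fin n) ℝ}, P.PosDef →
      (K * ((Q⁻¹ + T)⁻¹ + Aᵀ * P * A)⁻¹ * Kᵀ).PosDef := fun hP =>
    (hsum hP).inv.mul_mul_transpose_same (vecMul_injective_of_isUnit hKu)
  have hbound : ∀ {P : Matrix (Fin n) (Fin n) ℝ}, P.PosDef → ∀ v : Fin n → ℝ,
      v ⬝ᵥ ((K * ((Q⁻¹ + T)⁻¹ + Aᵀ * P * A)⁻¹ * Kᵀ) *ᵥ v) ≤ ζ * (v ⬝ᵥ v) := fun {P} hP v => by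
    have h1 := dotProduct_mulVec_le_opNorm2_mul (Q * (Q⁻¹ + T) * Q)⁻¹ v
    rw [← hζ', ← hKGK] at h1
    refine le_trans ?_ h1
    have hN := (hcongr hP).inv.add hG
    have h2 := quadForm_congruence ((Q⁻¹ + T)⁻¹ + Aᵀ * P * A)⁻¹ Kᵀ v
    have h3 := quadForm_congruence (Q⁻¹ + T) Kᵀ v
    rw [transpose_transpose] at h2 h3
    have hGt : (Q⁻¹ + T)ᵀ = Q⁻¹ + T := by simpa using hG.isHermitian.eq
    have h4 : 0 ≤ (Kᵀ *ᵥ v) ⬝ᵥ (((Q⁻¹ + T) * ((Aᵀ * P * A)⁻¹ + (Q⁻¹ + T))⁻¹ * (Q⁻¹ + T)) *ᵥ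
        (Kᵀ *ᵥ v)) := by
      have := (hN.inv.transpose_mul_mul_posSemidef (Q⁻¹ + T)).dotProduct_mulVec_nonneg (Kᵀ *ᵥ v)
      rw [hGt] at this
      simpa using this
    rw [← h2, ← h3, hG.inv.add_inv_eq_sub (hcongr hP), hG.inv_inv, sub_mulVec, dotProduct_sub]
    linarith
  have hrate : ∀ {P : Matrix (Fin n) (Fin n) ℝ}, P.PosDef → ∀ v : Fin n → ℝ,
      v ⬝ᵥ ((K * ((Q⁻¹ + T)⁻¹ + Aᵀ * P * A)⁻¹ * Kᵀ) *ᵥ v) ≤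
        ρ * (v ⬝ᵥ (E *ᵥ v) + v ⬝ᵥ ((K * ((Q⁻¹ + T)⁻¹ + Aᵀ * P * A)⁻¹ * Kᵀ) *ᵥ v)) :=
    fun hP v => by
    have h1 := lambdaMin_mul_dotProduct_le hE.isHermitian v
    rw [← hε'] at h1
    rw [hρ, div_mul_eq_mul_div, le_div_iff₀ (by linarith)]
    nlinarith [mul_le_mul_of_nonneg_left (hbound hP v) hε0.le, mul_le_mul_of_nonneg_left h1 hζ0]
  have hone : ∀ {P : Matrix (Fin n) (Fin n) ℝ}, ∀ v : Fin n → ℝ, v ⬝ᵥ (P *ᵥ v) ≤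
      1 * (v ⬝ᵥ ((Q⁻¹ + T)⁻¹ *ᵥ v) + v ⬝ᵥ (P *ᵥ v)) := fun v => by
    have := hG.inv.posSemidef.dotProduct_mulVec_nonneg v
    rw [star_trivial] at this
    linarith
  calc riemannianDist (ricOp A Q B R X) (ricOp A Q B R Y)
      = riemannianDist (E + K * ((Q⁻¹ + T)⁻¹ + Aᵀ * X * A)⁻¹ * Kᵀ)
          (E + K * ((Q⁻¹ + T)⁻¹ + Aᵀ * Y * A)⁻¹ * Kᵀ) := by
        rw [← riemannianDist_inv (hric hX) (hric hY), hinv hX, hinv hY]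
    _ ≤ ρ * riemannianDist (K * ((Q⁻¹ + T)⁻¹ + Aᵀ * X * A)⁻¹ * Kᵀ)
          (K * ((Q⁻¹ + T)⁻¹ + Aᵀ * Y * A)⁻¹ * Kᵀ) :=
        riemannianDist_add_le hρ0 hE.posSemidef (hKP hX) (hKP hY) (hrate hX) (hrate hY)
    _ = ρ * riemannianDist ((Q⁻¹ + T)⁻¹ + Aᵀ * X * A) ((Q⁻¹ + T)⁻¹ + Aᵀ * Y * A) := by
        rw [riemannianDist_congr hKdet, riemannianDist_inv (hsum hX) (hsum hY)]
    _ ≤ ρ * (1 * riemannianDist (Aᵀ * X * A) (Aᵀ * Y * A)) :=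
        mul_le_mul_of_nonneg_left (riemannianDist_add_le zero_le_one hG.inv.posSemidef
          (hcongr hX) (hcongr hY) hone hone) hρ0
    _ = ρ * riemannianDist X Y := by
        have h := riemannianDist_congr (L := Aᵀ) (by rwa [det_transpose]) X Y
        rw [transpose_transpose] at h
        rw [one_mul, h]
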